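/- arXiv:2102.00760 — 2 statements merged into one kernel-verified Lean document; each statement's English description precedes it below -/
import Mathlib

section
/- Rates under low-density separation: assume Z finite, the low-density (Tsybakov margin) condition P_{X∼ρ_X}(d(g*(X), F) < t) ≤ c_α t^α for all t > 0 (with α > 0, c_α > 0), and concentration: for some L, M > 0 and all t > 0, sup_{x∈supp ρ_X} P(‖g_n(ω,x) − g*(x)‖ > t) ≤ exp(−L t²/(1 + M t)), where g_n : Ω×X → H is jointly measurable on a probability space (Ω,P). Then there exists a constant c > 0 depending only on α such that, for f_n(ω) a decoding of g_n(ω,·) and f* a decoding of g*, E_ω[R(f_n(ω))] − R(f*) ≤ 2 c_ψ c_α c ( M^{α+1} L^{−(α+1)} + L^{−(α+1)/2} ). -/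
open MeasureTheory ProbabilityTheory Real
open scoped RealInnerProductSpace ENNReal

noncomputable section

universe uX uY uZ uH uO

variable {X Y Z H : Type*}
variable [MeasurableSpace X] [MeasurableSpace Y]
variable [Fintype Z] [Nonempty Z] [MeasurableSpace Z] [MeasurableSingletonClass Z]
variable [NormedAddCommGroup H] [InnerProductSpace ℝ H] [CompleteSpace H]

/-- The risk of a predictor `f : X → Z` for the loss `ℓ(z, y) = ⟪ψ z, φ y⟫`. -/
def risk (ψ : Z → H) (φ : Y → H) (ρ : Measure (X × Y)) (f : X → Z) : ℝ :=
  ∫ p, ⟪ψ (f p.1), φ p.2⟫ ∂ρ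

/-- The surrogate conditional mean `g*(x) = E_{Y ∼ ρ|ₓ}[φ(Y)]`, where `κ x = ρ|ₓ`. -/
def gStar (φ : Y → H) (κ : Kernel X Y) (x : X) : H :=
  ∫ y, φ y ∂(κ x)

/-- `f` is a (measurable) decoding of `g : X → H`. -/
def IsDecoding (ψ : Z → H) (g : X → H) (f : X → Z) : Prop :=
  Measurable f ∧ ∀ x z, ⟪ψ (f x), g x⟫ ≤ ⟪ψ z, g x⟫

/-- The decision frontier `F`. -/
def decisionFrontier (ψ : Z → H) : Set H :=
  {ξ | ∃ z₁ z₂ : Z, z₁ ≠ z₂ ∧ (∀ z, ⟪ψ z₁, ξ⟫ ≤ ⟪ψ z, ξ⟫) ∧ ∀ z, ⟪ψ z₂, ξ⟫ ≤ ⟪ψ z, ξ⟫}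

/-- Distance (in `ℝ≥0∞`) from a point to the decision frontier. -/
def dF (ψ : Z → H) (ξ : H) : ℝ≥0∞ :=
  EMetric.infEdist ξ (decisionFrontier ψ)

/-- The (topological) support of a measure. -/
def msupp {W : Type*} [TopologicalSpace W] [MeasurableSpace W] (μ : Measure W) : Set W :=
  {x | ∀ U : Set W, IsOpen U → x ∈ U → 0 < μ U}

lemma aux_frontier {Z H : Type*} [Fintype Z] [NormedAddCommGroup H] [InnerProductSpace ℝ H]
    (ψ : Z → H) (ξ η : H) (z w : Z) (hzw : z ≠ w)
    (hz : ∀ v, ⟪ψ z, ξ⟫ ≤ ⟪ψ v, ξ⟫) (hw : ∀ v, ⟪ψ w, η⟫ ≤ ⟪ψ v, η⟫) :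
    dF ψ ξ ≤ ENNReal.ofReal ‖η - ξ‖ := by
  classical
  have hc : ∀ z : Z, IsClosed {ζ : H | ∀ v, ⟪ψ z, ζ⟫ ≤ ⟪ψ v, ζ⟫} := by
    intro z
    simp only [Set.ofPred_forall]
    exact isClosed_iInter fun v => isClosed_le (by fun_prop) (by fun_prop)
  have hB : IsClosed (⋃ z' ∈ {z' : Z | z' ≠ z}, {ζ : H | ∀ v, ⟪ψ z', ζ⟫ ≤ ⟪ψ v, ζ⟫}) :=
    (Set.toFinite _).isClosed_biUnion fun i _ => hc i
  have hpre : IsPreconnected (segment ℝ ξ η) := (convex_segment ξ η).isPreconnected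
  rw [isPreconnected_closed_iff] at hpre
  obtain ⟨ζ, hζs, hζA, hζB⟩ := hpre _ _ (hc z) hB (by
      intro ζ _
      have : Nonempty Z := ⟨z⟩
      obtain ⟨m, hm⟩ := Finite.exists_min (fun v => ⟪ψ v, ζ⟫)
      by_cases h : m = z
      · left; subst h; exact hm
      · right
        simp only [Set.mem_iUnion]
        exact ⟨m, h, hm⟩)
    ⟨ξ, left_mem_segment ℝ ξ η, hz⟩
    ⟨η, right_mem_segment ℝ ξ η, by
      simp only [Set.mem_iUnion]
      exact ⟨w, hzw.symm, hw⟩⟩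
  simp only [Set.mem_iUnion] at hζB
  obtain ⟨z', hz', hm'⟩ := hζB
  have hmem : ζ ∈ decisionFrontier ψ := ⟨z, z', Ne.symm hz', hζA, hm'⟩
  refine (Metric.infEDist_le_edist_of_mem hmem).trans ?_
  rw [edist_dist]
  apply ENNReal.ofReal_le_ofReal
  rw [segment_eq_image'] at hζs
  obtain ⟨t, ht, rfl⟩ := hζs
  rw [dist_eq_norm]
  have : ξ - (ξ + t • (η - ξ)) = -(t • (η - ξ)) := by abel
  rw [this, norm_neg, norm_smul, Real.norm_of_nonneg ht.1]
  exact mul_le_of_le_one_left (norm_nonneg _) ht.2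

lemma aux_summable (α : ℝ) :
    Summable (fun k : ℕ => ((k : ℝ) + 1) * ((k : ℝ) + 2) ^ α * exp (-(k : ℝ) / 2)) := by
  obtain ⟨n, hn⟩ := exists_nat_ge α
  have hr : ‖exp (-1 / 2 : ℝ)‖ < 1 := by
    rw [Real.norm_of_nonneg (exp_pos _).le]
    exact Real.exp_lt_one_iff.2 (by norm_num)
  have h1 := summable_pow_mul_geometric_of_norm_lt_one (n + 1) hr
  have h2 := ((summable_nat_add_iff 2).2 h1).mul_left (exp 1)
  refine Summable.of_nonneg_of_le (fun k => by positivity) (fun k => ?_) h2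
  have e1 : exp 1 * exp (-1 / 2 : ℝ) ^ (k + 2) = exp (-(k : ℝ) / 2) := by
    rw [← Real.exp_nat_mul, ← Real.exp_add]; congr 1; push_cast; ring
  have e2 : ((k : ℝ) + 2) ^ α ≤ ((k : ℝ) + 2) ^ n := by
    rw [← Real.rpow_natCast]
    exact Real.rpow_le_rpow_of_exponent_le (by linarith [(Nat.cast_nonneg k : (0 : ℝ) ≤ k)]) hn
  calc ((k : ℝ) + 1) * ((k : ℝ) + 2) ^ α * exp (-(k : ℝ) / 2)
      ≤ ((k : ℝ) + 2) * ((k : ℝ) + 2) ^ n * exp (-(k : ℝ) / 2) := by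
        gcongr; norm_num
    _ = _ := by rw [← e1]; push_cast; ring

lemma aux_scale (α L M : ℝ) (hL : 0 < L) (hM : 0 < M) :
    ∃ s : ℝ, 0 < s ∧
      s ^ (α + 1) ≤ M ^ (α + 1) * L ^ (-(α + 1)) + L ^ (-(α + 1) / 2) ∧
      ∀ k : ℕ, 0 < k → exp (-(L * (k * s) ^ 2) / (1 + M * (k * s))) ≤ exp (-(k : ℝ) / 2) := by
  set s := max (M / L) (L ^ (-(1 / 2) : ℝ)) with hs
  have hs0 : 0 < s := lt_max_of_lt_left (div_pos hM hL)
  refine ⟨s, hs0, ?_, ?_⟩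
  · rcases max_cases (M / L) (L ^ (-(1 / 2) : ℝ)) with ⟨h, _⟩ | ⟨h, _⟩
    · rw [hs, h, Real.div_rpow hM.le hL.le, Real.rpow_neg hL.le, div_eq_mul_inv]
      exact le_add_of_nonneg_right (by positivity)
    · rw [hs, h, ← Real.rpow_mul hL.le]
      have : -(1 / 2) * (α + 1) = -(α + 1) / 2 := by ring
      rw [this]
      exact le_add_of_nonneg_left (by positivity)
  · intro k hk
    have hk1 : (1 : ℝ) ≤ k := by exact_mod_cast hk
    have h1 : M ≤ L * s := by
      have := le_max_left (M / L) (L ^ (-(1 / 2) : ℝ))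
      rw [← hs, div_le_iff₀ hL] at this
      linarith
    have h2 : 1 ≤ L * s ^ 2 := by
      have h := le_max_right (M / L) (L ^ (-(1 / 2) : ℝ))
      rw [← hs] at h
      have h3 : (L ^ (-(1 / 2) : ℝ)) ^ 2 = L⁻¹ := by
        rw [← Real.rpow_natCast, ← Real.rpow_mul hL.le, ← Real.rpow_neg_one]
        norm_num
      have h4 : L⁻¹ ≤ s ^ 2 := by
        rw [← h3]; gcongr
      calc (1 : ℝ) = L * L⁻¹ := (mul_inv_cancel₀ hL.ne').symm
        _ ≤ _ := by gcongr
    apply Real.exp_le_exp.2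
    have hp : 0 < 1 + M * (k * s) := by positivity
    rw [neg_div, neg_div, neg_le_neg_iff, le_div_iff₀ hp]
    have h5 : M * s ≤ L * s ^ 2 := by nlinarith
    have hA : (k : ℝ) * 1 ≤ k * (k * (L * s ^ 2)) := by
      gcongr; nlinarith
    have hB : (k : ℝ) * (k * (M * s)) ≤ k * (k * (L * s ^ 2)) := by gcongr
    nlinarith

lemma aux_pointwise {Z H : Type*} [Fintype Z] [NormedAddCommGroup H] [InnerProductSpace ℝ H]
    (ψ : Z → H) (cψ : ℝ) (hψ : ∀ z, ‖ψ z‖ ≤ cψ) (ξ η : H) (z w : Z)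
    (hz : ∀ v, ⟪ψ z, ξ⟫ ≤ ⟪ψ v, ξ⟫) (hw : ∀ v, ⟪ψ w, η⟫ ≤ ⟪ψ v, η⟫) (s : ℝ) (hs : 0 < s) :
    ENNReal.ofReal ⟪ψ w - ψ z, ξ⟫ ≤ ∑' k : ℕ, ENNReal.ofReal (2 * cψ * ((k + 1) * s)) *
      (Set.indicator {ζ | dF ψ ζ < ENNReal.ofReal ((k + 2) * s)} 1 ξ *
        Set.indicator {r : ℝ | k * s < r} 1 ‖η - ξ‖) := by
  by_cases hzw : z = w
  · subst hzw; simp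
  have hd := aux_frontier ψ ξ η z w hzw hz hw
  have hc : 0 ≤ cψ := (norm_nonneg _).trans (hψ z)
  have hex : ⟪ψ w - ψ z, ξ⟫ ≤ 2 * cψ * ‖η - ξ‖ := by
    have h1 : ⟪ψ w - ψ z, ξ⟫ = ⟪ψ w - ψ z, η⟫ - ⟪ψ w - ψ z, η - ξ⟫ := by
      rw [inner_sub_right]; ring
    have h2 : ⟪ψ w - ψ z, η⟫ ≤ 0 := by
      rw [inner_sub_left]; linarith [hw z]
    have h3 : -⟪ψ w - ψ z, η - ξ⟫ ≤ ‖ψ w - ψ z‖ * ‖η - ξ‖ :=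
      (neg_le_abs _).trans (abs_real_inner_le_norm _ _)
    have h4 : ‖ψ w - ψ z‖ ≤ 2 * cψ :=
      (norm_sub_le _ _).trans (by linarith [hψ w, hψ z])
    have h5 := mul_le_mul_of_nonneg_right h4 (norm_nonneg (η - ξ))
    linarith
  rcases (norm_nonneg (η - ξ)).eq_or_lt with h0 | h0
  · rw [← h0, mul_zero] at hex
    rw [ENNReal.ofReal_of_nonpos hex]; exact zero_le
  set δ := ‖η - ξ‖ with hδ
  have hpos : 0 < ⌈δ / s⌉₊ := Nat.ceil_pos.2 (div_pos h0 hs)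
  obtain ⟨k, hk⟩ := Nat.exists_eq_succ_of_ne_zero hpos.ne'
  have hle : δ ≤ (k + 1) * s := by
    have := Nat.le_ceil (δ / s)
    rw [hk, div_le_iff₀ hs] at this
    exact_mod_cast this
  have hlt : k * s < δ := by
    have : k < ⌈δ / s⌉₊ := by omega
    rw [Nat.lt_ceil, lt_div_iff₀ hs] at this
    exact this
  refine le_trans ?_ (ENNReal.le_tsum k)
  have m1 : ξ ∈ {ζ | dF ψ ζ < ENNReal.ofReal ((k + 2) * s)} := by
    refine hd.trans_lt ((ENNReal.ofReal_lt_ofReal_iff (by positivity)).2 ?_)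
    linarith
  have m2 : δ ∈ {r : ℝ | k * s < r} := hlt
  rw [Set.indicator_of_mem m1, Set.indicator_of_mem m2]
  simp only [Pi.one_apply, mul_one]
  apply ENNReal.ofReal_le_ofReal
  exact hex.trans (by gcongr)

lemma aux_msupp {X : Type*} [TopologicalSpace X] [SecondCountableTopology X] [MeasurableSpace X]
    (μ : Measure X) : ∀ᵐ x ∂μ, x ∈ msupp μ := by
  filter_upwards [Measure.support_mem_ae (μ := μ)] with x hx U hU hxU
  exact (Measure.mem_support_iff_forall x).1 hx U (hU.mem_nhds hxU)

lemma aux_risk {X Y Z H : Type*} [MeasurableSpace X] [MeasurableSpace Y] [Fintype Z]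
    [MeasurableSpace Z] [MeasurableSingletonClass Z]
    [NormedAddCommGroup H] [InnerProductSpace ℝ H] [CompleteSpace H]
    [SecondCountableTopology H] [MeasurableSpace H] [BorelSpace H]
    (ψ : Z → H) (φ : Y → H) (cψ : ℝ) (hψ : ∀ z, ‖ψ z‖ ≤ cψ)
    (μ : Measure X) [IsProbabilityMeasure μ] (κ : Kernel X Y) [IsMarkovKernel κ]
    (hφ : Integrable (fun p : X × Y => φ p.2) (μ ⊗ₘ κ))
    (f g : X → Z) (hf : Measurable f) (hg : Measurable g) :
    risk ψ φ (μ ⊗ₘ κ) f - risk ψ φ (μ ⊗ₘ κ) g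
      = ∫ x, ⟪ψ (f x) - ψ (g x), gStar φ κ x⟫ ∂μ := by
  have hm : ∀ f : X → Z, Measurable f → Measurable fun p : X × Y => ψ (f p.1) :=
    fun f hf => (measurable_of_finite ψ).comp (hf.comp measurable_fst)
  have hi : ∀ f : X → Z, Measurable f →
      Integrable (fun p : X × Y => ⟪ψ (f p.1), φ p.2⟫) (μ ⊗ₘ κ) := by
    intro f hf
    refine (hφ.norm.const_mul cψ).mono'
      ((hm f hf).aestronglyMeasurable.inner hφ.aestronglyMeasurable) (.of_forall fun p => ?_)
    exact (norm_inner_le_norm _ _).trans (by gcongr; exact hψ _)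
  unfold risk
  rw [← integral_sub (hi f hf) (hi g hg)]
  refine (Measure.integral_compProd ((hi f hf).sub (hi g hg))).trans ?_
  apply integral_congr_ae
  have := ((Measure.integrable_compProd_iff hφ.aestronglyMeasurable).1 hφ).1
  filter_upwards [this] with x hx
  simp only [Pi.sub_apply, ← inner_sub_left]
  exact integral_inner hx _

set_option maxHeartbeats 1000000 in
/-- **Optimal rates under low-density separation** (Tsybakov margin condition): there is a
constant `c > 0` depending only on `α` such that, for any structured prediction problem
satisfying the `α`-margin condition and a Bernstein-type pointwise concentration of the
surrogate estimates, the expected excess risk is bounded by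
`2 cψ cα c (M^(α+1) L^(−(α+1)) + L^(−(α+1)/2))`. -/
theorem rates_low_density_separation (α : ℝ) (hα : 0 < α) :
    ∃ c : ℝ, 0 < c ∧
      ∀ (X : Type uX) (Y : Type uY) (Z : Type uZ) (H : Type uH) (Ω : Type uO)
        [TopologicalSpace X] [PolishSpace X] [MeasurableSpace X] [BorelSpace X]
        [MeasurableSpace Y] [MeasurableSpace Ω]
        [Fintype Z] [Nonempty Z] [MeasurableSpace Z] [MeasurableSingletonClass Z]
        [NormedAddCommGroup H] [InnerProductSpace ℝ H] [CompleteSpace H]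
        [SecondCountableTopology H] [MeasurableSpace H] [BorelSpace H]
        (ψ : Z → H) (φ : Y → H) (cψ : ℝ), (∀ z, ‖ψ z‖ ≤ cψ) → Measurable φ →
      ∀ (μ : Measure X), IsProbabilityMeasure μ →
      ∀ (κ : Kernel X Y), IsMarkovKernel κ →
        Integrable (fun p : X × Y => ‖φ p.2‖ ^ 2) (μ ⊗ₘ κ) →
      ∀ cα : ℝ, 0 < cα →
        (∀ t : ℝ, 0 < t →
          μ {x | dF ψ (gStar φ κ x) < ENNReal.ofReal t} ≤ ENNReal.ofReal (cα * t ^ α)) →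
      ∀ (P : Measure Ω), IsProbabilityMeasure P →
      ∀ (gn : Ω → X → H), Measurable (Function.uncurry gn) →
      ∀ L M : ℝ, 0 < L → 0 < M →
        (∀ t : ℝ, 0 < t → ∀ x ∈ msupp μ,
          P {ω | t < ‖gn ω x - gStar φ κ x‖}
            ≤ ENNReal.ofReal (exp (-(L * t ^ 2) / (1 + M * t)))) →
      ∀ (fn : Ω → X → Z), (∀ ω, IsDecoding ψ (gn ω) (fn ω)) →
        Measurable (Function.uncurry fn) →
      ∀ (fstar : X → Z), IsDecoding ψ (gStar φ κ) fstar →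
        (∫ ω, risk ψ φ (μ ⊗ₘ κ) (fn ω) ∂P) - risk ψ φ (μ ⊗ₘ κ) fstar
          ≤ 2 * cψ * cα * c * (M ^ (α + 1) * L ^ (-(α + 1)) + L ^ (-(α + 1) / 2)) := by
  have hsum := aux_summable α
  refine ⟨∑' k : ℕ, ((k : ℝ) + 1) * ((k : ℝ) + 2) ^ α * exp (-(k : ℝ) / 2),
    hsum.tsum_pos (fun k => by positivity) 0 (by positivity), ?_⟩
  intro X Y Z H Ω _ _ _ _ _ _ _ _ _ _ _ _ _ _ _ _ ψ φ cψ hψ hφm μ hμ κ hκ hφ2 cα hcα hmargin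
    P hP gn hgn L M hL hM hconc fn hfn hfnm fstar hfstar
  obtain ⟨s, hs, hsb, hsk⟩ := aux_scale α L M hL hM
  have hc0 : 0 ≤ cψ := (norm_nonneg _).trans (hψ (Classical.arbitrary Z))
  have hφ : Integrable (fun p : X × Y => φ p.2) (μ ⊗ₘ κ) := by
    have hm : AEStronglyMeasurable (fun p : X × Y => φ p.2) (μ ⊗ₘ κ) :=
      (hφm.comp measurable_snd).aestronglyMeasurable
    exact ((memLp_two_iff_integrable_sq_norm hm).2 hφ2).integrable (by norm_num)
  have hgs : Measurable (gStar φ κ) :=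
    (StronglyMeasurable.integral_kernel hφm.stronglyMeasurable).measurable
  -- integrability of the risk in `ω`
  have hRint : Integrable (fun ω => risk ψ φ (μ ⊗ₘ κ) (fn ω)) P := by
    have hmeas : StronglyMeasurable (fun ω => risk ψ φ (μ ⊗ₘ κ) (fn ω)) := by
      unfold risk
      refine StronglyMeasurable.integral_prod_right
        (f := fun ω (p : X × Y) => ⟪ψ (fn ω p.1), φ p.2⟫) ?_
      apply Measurable.stronglyMeasurable
      have h1 : Measurable fun q : Ω × (X × Y) => ψ (fn q.1 q.2.1) :=
        (measurable_of_finite ψ).comp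
          (hfnm.comp (measurable_fst.prodMk (measurable_fst.comp measurable_snd)))
      have h2 : Measurable fun q : Ω × (X × Y) => φ q.2.2 :=
        hφm.comp (measurable_snd.comp measurable_snd)
      exact h1.inner h2
    refine Integrable.mono' (integrable_const (∫ p, cψ * ‖φ p.2‖ ∂(μ ⊗ₘ κ)))
      hmeas.aestronglyMeasurable (.of_forall fun ω => ?_)
    refine norm_integral_le_of_norm_le (hφ.norm.const_mul cψ) (.of_forall fun p => ?_)
    exact (norm_inner_le_norm _ _).trans (by gcongr; exact hψ _)
  have hnn : ∀ ω x, 0 ≤ ⟪ψ (fn ω x) - ψ (fstar x), gStar φ κ x⟫ := by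
    intro ω x
    rw [inner_sub_left]
    linarith [hfstar.2 x (fn ω x)]
  have hEq : (∫ ω, risk ψ φ (μ ⊗ₘ κ) (fn ω) ∂P) - risk ψ φ (μ ⊗ₘ κ) fstar
      = ∫ ω, ∫ x, ⟪ψ (fn ω x) - ψ (fstar x), gStar φ κ x⟫ ∂μ ∂P := by
    have : ∀ ω, ∫ x, ⟪ψ (fn ω x) - ψ (fstar x), gStar φ κ x⟫ ∂μ
        = risk ψ φ (μ ⊗ₘ κ) (fn ω) - risk ψ φ (μ ⊗ₘ κ) fstar := fun ω =>
      (aux_risk ψ φ cψ hψ μ κ hφ (fn ω) fstar (hfn ω).1 hfstar.1).symm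
    simp_rw [this]
    rw [integral_sub hRint (integrable_const _)]
    simp
  have hmh : Measurable fun q : Ω × X => ⟪ψ (fn q.1 q.2) - ψ (fstar q.2), gStar φ κ q.2⟫ := by
    have h1 : Measurable fun q : Ω × X => ψ (fn q.1 q.2) := (measurable_of_finite ψ).comp hfnm
    have h2 : Measurable fun q : Ω × X => ψ (fstar q.2) :=
      (measurable_of_finite ψ).comp (hfstar.1.comp measurable_snd)
    exact (h1.sub h2).inner (hgs.comp measurable_snd)
  let T : ℕ → Ω → X → ℝ≥0∞ := fun k ω x =>
    Set.indicator {ζ | dF ψ ζ < ENNReal.ofReal ((k + 2) * s)} 1 (gStar φ κ x) *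
        Set.indicator {r : ℝ | k * s < r} 1 ‖gn ω x - gStar φ κ x‖
  have hAm : ∀ k : ℕ, MeasurableSet {ζ : H | dF ψ ζ < ENNReal.ofReal ((k + 2) * s)} :=
    fun k => measurableSet_lt Metric.continuous_infEDist.measurable measurable_const
  have hI1 : ∀ k : ℕ, Measurable fun x : X =>
      Set.indicator {ζ | dF ψ ζ < ENNReal.ofReal ((k + 2) * s)} (1 : H → ℝ≥0∞) (gStar φ κ x) :=
    fun k => (measurable_one.indicator (hAm k)).comp hgs
  have hI2 : ∀ k : ℕ, Measurable fun q : Ω × X =>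
      Set.indicator {r : ℝ | k * s < r} (1 : ℝ → ℝ≥0∞) ‖gn q.1 q.2 - gStar φ κ q.2‖ :=
    fun k => (measurable_one.indicator measurableSet_Ioi).comp
      (hgn.sub (hgs.comp measurable_snd)).norm
  have hTm : ∀ k, Measurable (Function.uncurry (T k)) := fun k =>
    ((hI1 k).comp measurable_snd).mul (hI2 k)
  have hT : ∀ k : ℕ, ∫⁻ ω, ∫⁻ x, T k ω x ∂μ ∂P ≤
      ENNReal.ofReal (exp (-(k : ℝ) / 2) * (cα * ((k + 2) * s) ^ α)) := by
    intro k
    rw [lintegral_lintegral_swap (hTm k).aemeasurable, ENNReal.ofReal_mul (exp_pos _).le]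
    calc ∫⁻ x, ∫⁻ ω, T k ω x ∂P ∂μ
        ≤ ∫⁻ x, ENNReal.ofReal (exp (-(k : ℝ) / 2)) *
          Set.indicator {ζ | dF ψ ζ < ENNReal.ofReal ((k + 2) * s)} 1 (gStar φ κ x) ∂μ := by
          apply lintegral_mono_ae
          filter_upwards [aux_msupp μ] with x hx
          have hmx : Measurable fun ω =>
              Set.indicator {r : ℝ | k * s < r} (1 : ℝ → ℝ≥0∞) ‖gn ω x - gStar φ κ x‖ :=
            (hI2 k).comp measurable_prodMk_right
          rw [lintegral_const_mul _ hmx, mul_comm]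
          gcongr
          have hset : MeasurableSet {ω | k * s < ‖gn ω x - gStar φ κ x‖} :=
            measurableSet_lt measurable_const
              ((hgn.comp measurable_prodMk_right).sub measurable_const).norm
          have : ∫⁻ ω, Set.indicator {r : ℝ | k * s < r} (1 : ℝ → ℝ≥0∞) ‖gn ω x - gStar φ κ x‖ ∂P
              = P {ω | k * s < ‖gn ω x - gStar φ κ x‖} := by
            rw [← lintegral_indicator_one hset]; rfl
          rw [this]
          rcases Nat.eq_zero_or_pos k with h0 | h0
          · subst h0
            simpa using prob_le_one
          · exact (hconc (k * s) (by positivity) x hx).trans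
              (ENNReal.ofReal_le_ofReal (hsk k h0))
      _ = ENNReal.ofReal (exp (-(k : ℝ) / 2)) *
            μ {x | dF ψ (gStar φ κ x) < ENNReal.ofReal ((k + 2) * s)} := by
          rw [lintegral_const_mul _ (hI1 k)]
          congr 1
          exact lintegral_indicator_one (hgs (hAm k))
      _ ≤ _ := by
          gcongr
          exact hmargin _ (by positivity)
  have hpt : ∀ ω x, ENNReal.ofReal ⟪ψ (fn ω x) - ψ (fstar x), gStar φ κ x⟫ ≤
      ∑' k : ℕ, ENNReal.ofReal (2 * cψ * ((k + 1) * s)) * T k ω x := fun ω x =>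
    aux_pointwise ψ cψ hψ (gStar φ κ x) (gn ω x) (fstar x) (fn ω x)
      (hfstar.2 x) ((hfn ω).2 x) s hs
  clear_value T
  have hmain : ∫⁻ ω, ∫⁻ x, ENNReal.ofReal ⟪ψ (fn ω x) - ψ (fstar x), gStar φ κ x⟫ ∂μ ∂P
      ≤ ENNReal.ofReal (2 * cψ * cα *
        (∑' k : ℕ, ((k : ℝ) + 1) * ((k : ℝ) + 2) ^ α * exp (-(k : ℝ) / 2)) * s ^ (α + 1)) := by
    calc _ ≤ ∫⁻ ω, ∫⁻ x, ∑' k : ℕ, ENNReal.ofReal (2 * cψ * ((k + 1) * s)) * T k ω x ∂μ ∂P :=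
          lintegral_mono fun ω => lintegral_mono fun x => hpt ω x
      _ = ∑' k : ℕ, ENNReal.ofReal (2 * cψ * ((k + 1) * s)) * ∫⁻ ω, ∫⁻ x, T k ω x ∂μ ∂P := by
          have e1 : ∀ ω, ∫⁻ x, ∑' k : ℕ, ENNReal.ofReal (2 * cψ * ((k + 1) * s)) * T k ω x ∂μ
              = ∑' k : ℕ, ENNReal.ofReal (2 * cψ * ((k + 1) * s)) * ∫⁻ x, T k ω x ∂μ := by
            intro ω
            have hm : ∀ k, Measurable (T k ω) := fun k => (hTm k).comp measurable_prodMk_left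
            rw [lintegral_tsum fun k => ((hm k).const_mul _).aemeasurable]
            exact tsum_congr fun k => lintegral_const_mul _ (hm k)
          simp_rw [e1]
          have hm : ∀ k, Measurable fun ω => ∫⁻ x, T k ω x ∂μ :=
            fun k => (hTm k).lintegral_prod_right'
          rw [lintegral_tsum fun k => ((hm k).const_mul _).aemeasurable]
          exact tsum_congr fun k => lintegral_const_mul _ (hm k)
      _ ≤ ∑' k : ℕ, ENNReal.ofReal (2 * cψ * cα * s ^ (α + 1) *
            (((k : ℝ) + 1) * ((k : ℝ) + 2) ^ α * exp (-(k : ℝ) / 2))) := by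
          refine ENNReal.tsum_le_tsum fun k => ?_
          refine (mul_le_mul_right (hT k) _).trans ?_
          rw [← ENNReal.ofReal_mul (by positivity)]
          apply le_of_eq
          congr 1
          rw [Real.mul_rpow (by positivity) hs.le, Real.rpow_add hs, Real.rpow_one]
          ring
      _ = _ := by
          rw [← ENNReal.ofReal_tsum_of_nonneg (fun k => by positivity) (hsum.mul_left _),
            tsum_mul_left]
          congr 1; ring
  rw [hEq, integral_eq_lintegral_of_nonneg_ae
    (.of_forall fun ω => integral_nonneg (hnn ω))
    (hmh.stronglyMeasurable.integral_prod_right'.aestronglyMeasurable)]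
  have hS : 0 ≤ ∑' k : ℕ, ((k : ℝ) + 1) * ((k : ℝ) + 2) ^ α * exp (-(k : ℝ) / 2) :=
    tsum_nonneg fun k => by positivity
  refine ENNReal.toReal_le_of_le_ofReal (by positivity) ?_
  calc _ ≤ ∫⁻ ω, ∫⁻ x, ENNReal.ofReal ⟪ψ (fn ω x) - ψ (fstar x), gStar φ κ x⟫ ∂μ ∂P := by
        refine lintegral_mono fun ω => ?_
        have hmo : Measurable fun x => ⟪ψ (fn ω x) - ψ (fstar x), gStar φ κ x⟫ :=
          hmh.comp measurable_prodMk_left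
        rw [integral_eq_lintegral_of_nonneg_ae (.of_forall (hnn ω)) hmo.aestronglyMeasurable]
        exact ENNReal.ofReal_toReal_le
    _ ≤ _ := hmain
    _ ≤ _ := ENNReal.ofReal_le_ofReal (by gcongr)
end
end

section
/- Bias concentration for nearest neighbors (second part of the nearest-neighbor concentration lemma): let (X,d) be a separable metric space, ρ_X a Borel probability measure, x ∈ supp ρ_X such that the cumulative distribution function of d(x, X₁), X₁ ∼ ρ_X, is continuous, and suppose g* : X → H satisfies the modified Lipschitz condition ‖g*(u) − g*(v)‖ ≤ c_β ρ_X(B(u, d(u,v)))^β for all u,v ∈ supp ρ_X. Let X₁, …, X_n be i.i.d. ρ_X, let g_n*(x) = Σ_i α_i(x) g*(X_i) with α_i(x) the k-nearest-neighbor weights, 1 ≤ k ≤ n. Then there exists b₃ > 0 depending only on c_β and β such that for every t > 0 with (t/c_β)^{1/β} ≥ 2k/n, P( ‖g_n*(x) − g*(x)‖ > t ) ≤ exp( − b₃ n t^{1/β} ). -/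
open MeasureTheory Real
open scoped ENNReal

noncomputable section

universe uX

/-- The `k`-nearest-neighbor weights at `x`, relative to sample points `v 0, …, v (n-1)`:
weight `1/k` on points strictly within the `k` nearest, `0` on points beyond the `k`-th
distance, and ties at the `k`-th distance split equally. -/
def nnWeight {X : Type*} [MetricSpace X] (n k : ℕ) (v : Fin n → X) (x : X) (i : Fin n) : ℝ :=
  if (Finset.univ.filter fun j => dist x (v j) ≤ dist x (v i)).card < k then 1 / k
  else if k ≤ (Finset.univ.filter fun j => dist x (v j) < dist x (v i)).card then 0
  else 1 / (((Finset.univ.filter fun j => dist x (v j) = dist x (v i)).card : ℝ) * k)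

lemma msupp_ae {X : Type*} [MetricSpace X] [TopologicalSpace.SeparableSpace X]
    [MeasurableSpace X] (μ : Measure X) : ∀ᵐ u ∂μ, u ∈ msupp μ := by
  haveI : SecondCountableTopology X := UniformSpace.secondCountable_of_separable X
  rw [ae_iff]
  refine measure_null_of_locally_null _ fun u hu => ?_
  simp only [msupp, Set.mem_setOf_eq, not_forall, not_lt, nonpos_iff_eq_zero] at hu
  obtain ⟨U, hU, huU, h0⟩ := hu
  exact ⟨U, mem_nhdsWithin_of_mem_nhds (hU.mem_nhds huU), h0⟩

lemma sphere_null {X : Type*} [MetricSpace X] [MeasurableSpace X] [BorelSpace X]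
    (μ : Measure X) [IsProbabilityMeasure μ] (x : X)
    (hc : Continuous (fun t : ℝ => (μ {u | dist x u ≤ t}).toReal)) (c : ℝ) :
    μ {u | dist x u = c} = 0 := by
  have hm : ∀ t : ℝ, MeasurableSet {u : X | dist x u ≤ t} := fun t =>
    (isClosed_le (by fun_prop) (by fun_prop)).measurableSet
  have h1 : ∀ t < c, (μ {u | dist x u = c}).toReal ≤
      (μ {u | dist x u ≤ c}).toReal - (μ {u | dist x u ≤ t}).toReal := by
    intro t ht
    have hsub : {u : X | dist x u ≤ t} ⊆ {u | dist x u ≤ c} := fun u hu => le_trans hu ht.le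
    have := measureReal_diff (μ := μ) hsub (hm t)
    simp only [measureReal_def] at this
    rw [← this]
    refine ENNReal.toReal_mono (measure_ne_top _ _) (measure_mono ?_)
    intro u hu
    simp only [Set.mem_setOf_eq] at hu
    simp [hu, ht]
  have h2 : Filter.Tendsto (fun t : ℝ => (μ {u | dist x u ≤ c}).toReal -
      (μ {u | dist x u ≤ t}).toReal) (nhdsWithin c (Set.Iio c)) (nhds 0) := by
    have := (tendsto_const_nhds (x := (μ {u | dist x u ≤ c}).toReal)).sub (hc.tendsto c)
    rw [sub_self] at this
    exact this.mono_left nhdsWithin_le_nhds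
  have h3 : (μ {u | dist x u = c}).toReal ≤ 0 :=
    ge_of_tendsto h2 (by filter_upwards [self_mem_nhdsWithin] with t ht using h1 t ht)
  have h4 := le_antisymm h3 ENNReal.toReal_nonneg
  rcases (ENNReal.toReal_eq_zero_iff _).1 h4 with h | h
  · exact h
  · exact absurd h (measure_ne_top _ _)

lemma noties_ae {X : Type*} [MetricSpace X] [MeasurableSpace X] [BorelSpace X]
    (μ : Measure X) [IsProbabilityMeasure μ] (x : X)
    (hc : Continuous (fun t : ℝ => (μ {u | dist x u ≤ t}).toReal)) (n : ℕ) :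
    ∀ᵐ ω ∂(Measure.pi (fun _ : Fin n => μ)), Function.Injective (fun i => dist x (ω i)) := by
  have key : ∀ i j : Fin n, i ≠ j →
      ∀ᵐ ω ∂(Measure.pi (fun _ : Fin n => μ)), dist x (ω i) ≠ dist x (ω j) := by
    intro i j hij
    have hmd : Measurable (fun u : X => dist x u) :=
      (continuous_const.dist continuous_id).measurable
    have hi : ProbabilityTheory.IndepFun (fun ω : Fin n → X => ω i) (fun ω : Fin n → X => ω j)
        (Measure.pi (fun _ : Fin n => μ)) := (ProbabilityTheory.iIndepFun_pi (μ := fun _ : Fin n => μ)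
      (X := fun _ => (id : X → X)) (fun _ => aemeasurable_id)).indepFun hij
    rw [ProbabilityTheory.indepFun_iff_map_prod_eq_prod_map_map
      (measurable_pi_apply i).aemeasurable (measurable_pi_apply j).aemeasurable] at hi
    have e : ∀ i : Fin n, Measure.map (fun ω : Fin n → X => ω i)
        (Measure.pi (fun _ : Fin n => μ)) = μ := fun i =>
      (measurePreserving_eval (fun _ : Fin n => μ) i).map_eq
    rw [e i, e j] at hi
    have hS : MeasurableSet {p : X × X | dist x p.1 = dist x p.2} :=
      measurableSet_eq_fun (hmd.comp measurable_fst) (hmd.comp measurable_snd)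
    have h0 : (μ.prod μ) {p : X × X | dist x p.1 = dist x p.2} = 0 := by
      rw [Measure.measure_prod_null hS]
      refine Filter.Eventually.of_forall fun u => ?_
      have := sphere_null μ x hc (dist x u)
      simpa [Set.preimage, eq_comm] using this
    rw [← hi, Measure.map_apply ((measurable_pi_apply i).prodMk (measurable_pi_apply j)) hS] at h0
    rw [ae_iff]
    simpa using h0
  have : ∀ᵐ ω ∂(Measure.pi (fun _ : Fin n => μ)), ∀ i j : Fin n, i ≠ j →
      dist x (ω i) ≠ dist x (ω j) := by
    rw [ae_all_iff]; intro i
    rw [ae_all_iff]; intro j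
    by_cases h : i = j
    · simp [h]
    · filter_upwards [key i j h] with ω hω _ using hω
  filter_upwards [this] with ω hω i j hij
  by_contra h
  exact hω i j h hij

lemma nnWeight_noties {X : Type*} [MetricSpace X] (n k : ℕ) (v : Fin n → X) (x : X)
    (hinj : Function.Injective (fun i => dist x (v i))) (i : Fin n) :
    nnWeight n k v x i =
      if (Finset.univ.filter fun j => dist x (v j) < dist x (v i)).card < k
        then (1 / k : ℝ) else 0 := by
  have h1 : (Finset.univ.filter fun j => dist x (v j) = dist x (v i)) = {i} := by
    ext j
    simp only [Finset.mem_filter, Finset.mem_univ, true_and, Finset.mem_singleton]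
    exact ⟨fun h => hinj h, fun h => by rw [h]⟩
  have h2 : (Finset.univ.filter fun j => dist x (v j) ≤ dist x (v i)).card =
      (Finset.univ.filter fun j => dist x (v j) < dist x (v i)).card + 1 := by
    have : (Finset.univ.filter fun j => dist x (v j) ≤ dist x (v i)) =
      insert i (Finset.univ.filter fun j => dist x (v j) < dist x (v i)) := by
      ext j
      simp only [Finset.mem_filter, Finset.mem_univ, true_and, Finset.mem_insert]
      constructor
      · intro h
        rcases h.lt_or_eq with h | h
        · exact Or.inr h
        · exact Or.inl (hinj h)
      · rintro (h | h)
        · rw [h]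
        · exact h.le
    rw [this, Finset.card_insert_of_notMem (by simp)]
  unfold nnWeight
  rw [h1, h2]
  simp only [Finset.card_singleton, Nat.cast_one, one_mul]
  split_ifs <;> first | rfl | omega

lemma nnWeight_sum {X : Type*} [MetricSpace X] (n k : ℕ) (hk : 1 ≤ k) (hkn : k ≤ n)
    (v : Fin n → X) (x : X)
    (hinj : Function.Injective (fun i => dist x (v i))) :
    ∑ i, nnWeight n k v x i = 1 := by
  have hlt : ∀ i : Fin n, (Finset.univ.filter fun j => dist x (v j) < dist x (v i)).card < n := by
    intro i
    have : (Finset.univ.filter fun j => dist x (v j) < dist x (v i)) ⊂ Finset.univ := by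
      refine Finset.filter_ssubset.2 ⟨i, Finset.mem_univ _, by simp⟩
    simpa using Finset.card_lt_card this
  let r : Fin n → Fin n := fun i => ⟨_, hlt i⟩
  have hmono : ∀ i j : Fin n, dist x (v i) < dist x (v j) → r i < r j := by
    intro i j hij
    show (Finset.univ.filter fun l => dist x (v l) < dist x (v i)).card <
      (Finset.univ.filter fun l => dist x (v l) < dist x (v j)).card
    refine Finset.card_lt_card ⟨?_, ?_⟩
    · intro l
      simp only [Finset.mem_filter, Finset.mem_univ, true_and]
      exact fun h => h.trans hij
    · intro h
      have := @h i (by simpa using hij)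
      simp at this
  have hr : Function.Injective r := by
    intro i j hij
    by_contra hne
    rcases lt_trichotomy (dist x (v i)) (dist x (v j)) with h | h | h
    · exact (hmono _ _ h).ne hij
    · exact hne (hinj h)
    · exact (hmono _ _ h).ne' hij
  have hb : Function.Bijective r := Finite.injective_iff_bijective.1 hr
  have e1 : ∑ i, nnWeight n k v x i = ∑ i, (if (r i : ℕ) < k then (1 / k : ℝ) else 0) :=
    Finset.sum_congr rfl fun i _ => nnWeight_noties n k v x hinj i
  rw [e1, hb.sum_comp (fun m : Fin n => if (m : ℕ) < k then (1 / k : ℝ) else 0)]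
  rw [Fin.sum_univ_eq_sum_range (fun m : ℕ => if m < k then (1 / k : ℝ) else 0) n]
  rw [← Finset.sum_filter]
  have : (Finset.range n).filter (fun m => m < k) = Finset.range k := by
    ext m; simp; omega
  rw [this]
  have : (k : ℝ) ≠ 0 := by positivity
  simp [this]

lemma nnWeight_nonneg {X : Type*} [MetricSpace X] (n k : ℕ)
    (v : Fin n → X) (x : X) (i : Fin n) : 0 ≤ nnWeight n k v x i := by
  unfold nnWeight
  split_ifs <;> positivity

/-- deterministic averaging bound -/
lemma avg_bound {H : Type*} [NormedAddCommGroup H] [InnerProductSpace ℝ H] (n : ℕ)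
    (w : Fin n → ℝ) (hw : ∀ i, 0 ≤ w i) (hs : ∑ i, w i = 1) (y : Fin n → H) (z : H) (t : ℝ)
    (h : ∀ i, w i ≠ 0 → ‖y i - z‖ ≤ t) : ‖(∑ i, w i • y i) - z‖ ≤ t := by
  have e : (∑ i, w i • y i) - z = ∑ i, w i • (y i - z) := by
    simp only [smul_sub, Finset.sum_sub_distrib, ← Finset.sum_smul, hs, one_smul]
  rw [e]
  calc ‖∑ i, w i • (y i - z)‖ ≤ ∑ i, w i * t := by
        refine norm_sum_le_of_le _ fun i _ => ?_
        rw [norm_smul, Real.norm_of_nonneg (hw i)]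
        by_cases h0 : w i = 0
        · simp [h0]
        · exact mul_le_mul_of_nonneg_left (h i h0) (hw i)
    _ = t := by rw [← Finset.sum_mul, hs, one_mul]

open Classical in
lemma chernoff_count {X : Type*} [MeasurableSpace X]
    (μ : Measure X) [IsProbabilityMeasure μ] (A : Set X) (hA : MeasurableSet A) (n k : ℕ)
    (s : ℝ) (hs : (μ A).toReal = s) (hk : 2 * (k : ℝ) ≤ n * s) :
    Measure.pi (fun _ : Fin n => μ)
      {ω | (Finset.univ.filter fun i => ω i ∈ A).card < k} ≤
        ENNReal.ofReal (exp (-(n * s / 8))) := by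
  set P := Measure.pi (fun _ : Fin n => μ)
  let f : X → ℝ := fun u => if u ∈ A then 1 / 2 else 1
  have hfm : Measurable f := Measurable.ite hA measurable_const measurable_const
  have hf01 : ∀ u, 0 ≤ f u ∧ f u ≤ 1 := by
    intro u; simp only [f]; split_ifs <;> norm_num
  have hint : ∫ u, f u ∂μ = 1 - s / 2 := by
    have : f = fun u => 1 - A.indicator (fun _ => (1 / 2 : ℝ)) u := by
      ext u; simp only [f, Set.indicator]; split_ifs <;> norm_num
    rw [this, integral_sub (integrable_const _) ((integrable_const _).indicator hA),
      integral_indicator_const _ hA]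
    simp [measureReal_def, hs]; ring
  let F : (Fin n → X) → ℝ := fun ω => ∏ i, f (ω i)
  have hFint : ∫ ω, F ω ∂P = (1 - s / 2) ^ n := by
    have := integral_fintype_prod_eq_pow (ι := Fin n) (μ := μ) f
    simp only [Fintype.card_fin, hint] at this
    exact this
  have hFm : Measurable F := Finset.measurable_prod _ fun i _ => hfm.comp (measurable_pi_apply i)
  have hF0 : ∀ ω, 0 ≤ F ω := fun ω => Finset.prod_nonneg fun i _ => (hf01 _).1
  have hF1 : ∀ ω, F ω ≤ 1 := fun ω =>
    Finset.prod_le_one (fun i _ => (hf01 _).1) (fun i _ => (hf01 _).2)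
  have hFi : Integrable F P := by
    refine Integrable.of_bound hFm.aestronglyMeasurable 1 (Filter.Eventually.of_forall fun ω => ?_)
    rw [Real.norm_of_nonneg (hF0 ω)]; exact hF1 ω
  have hFv : ∀ ω, F ω = (1 / 2 : ℝ) ^ (Finset.univ.filter fun i => ω i ∈ A).card := by
    intro ω
    simp only [F, f, Finset.prod_ite, Finset.prod_const, one_pow, mul_one]
  have hmark := mul_meas_ge_le_integral_of_nonneg (μ := P) (f := F)
    (Filter.Eventually.of_forall hF0) hFi ((1 / 2 : ℝ) ^ k)
  rw [hFint] at hmark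
  have hs1 : s ≤ 1 := by rw [← hs]; exact ENNReal.toReal_le_of_le_ofReal (by norm_num) (by simpa using prob_le_one)
  have hpow : (1 - s / 2) ^ n ≤ exp (-(n * s / 2)) := by
    calc (1 - s / 2) ^ n ≤ (exp (-(s / 2))) ^ n := by
          refine pow_le_pow_left₀ (by linarith) ?_ n
          have := add_one_le_exp (-(s / 2)); linarith
      _ = exp (-(n * s / 2)) := by rw [← exp_nat_mul]; congr 1; ring
  have hk2 : exp (-((k : ℝ) * log 2)) = (1 / 2 : ℝ) ^ k := by
    rw [show -((k : ℝ) * log 2) = k * (-log 2) by ring, exp_nat_mul, exp_neg, exp_log (by norm_num)]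
    norm_num
  have hfin : P.real {ω | (1 / 2 : ℝ) ^ k ≤ F ω} ≤ exp (-(n * s / 8)) := by
    have h1 : exp (-((k : ℝ) * log 2)) * P.real {ω | (1 / 2 : ℝ) ^ k ≤ F ω} ≤
        exp (-((k : ℝ) * log 2)) * exp (-(n * s / 8)) := by
      rw [← exp_add, hk2]
      refine (hmark.trans hpow).trans (exp_le_exp.2 ?_)
      have hl := log_two_lt_d9
      have hl0 : 0 < log 2 := log_pos (by norm_num)
      have hk0 : (0 : ℝ) ≤ k := by positivity
      nlinarith
    exact le_of_mul_le_mul_left h1 (exp_pos _)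
  calc P {ω | (Finset.univ.filter fun i => ω i ∈ A).card < k}
      ≤ P {ω | (1 / 2 : ℝ) ^ k ≤ F ω} := by
        refine measure_mono fun ω hω => ?_
        simp only [Set.mem_setOf_eq] at hω ⊢
        rw [hFv]
        exact pow_le_pow_of_le_one (by norm_num) (by norm_num) hω.le
    _ ≤ _ := by
        rw [← ENNReal.ofReal_toReal (measure_ne_top P {ω | (1 / 2 : ℝ) ^ k ≤ F ω})]
        exact ENNReal.ofReal_le_ofReal hfin

lemma exists_radius {X : Type*} [MetricSpace X] [MeasurableSpace X] [BorelSpace X]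
    (μ : Measure X) [IsProbabilityMeasure μ] (x : X)
    (hc : Continuous (fun t : ℝ => (μ {u | dist x u ≤ t}).toReal)) (s : ℝ) (h0 : 0 < s)
    (h1 : s < 1) : ∃ r : ℝ, (μ {u | dist x u ≤ r}).toReal = s := by
  have hlow : (μ {u | dist x u ≤ (-1 : ℝ)}).toReal = 0 := by
    have : {u | dist x u ≤ (-1 : ℝ)} = ∅ := by
      ext u
      simp only [Set.mem_setOf_eq, Set.mem_empty_iff_false, iff_false, not_le]
      linarith [dist_nonneg (x := x) (y := u)]
    simp [this]
  have htop : Filter.Tendsto (fun m : ℕ => μ {u | dist x u ≤ (m : ℝ)}) Filter.atTop (nhds 1) := by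
    have hu : (⋃ m : ℕ, {u | dist x u ≤ (m : ℝ)}) = Set.univ := by
      ext u; simpa using exists_nat_ge (dist x u)
    have := tendsto_measure_iUnion_atTop (μ := μ) (s := fun m : ℕ => {u | dist x u ≤ (m : ℝ)})
      (fun a b hab u (hu : dist x u ≤ (a : ℝ)) =>
        (le_trans hu (Nat.cast_le.2 hab) : dist x u ≤ (b : ℝ)))
    rwa [hu, measure_univ] at this
  have htop' := (ENNReal.tendsto_toReal (by norm_num : (1 : ℝ≥0∞) ≠ ⊤)).comp htop
  rw [ENNReal.toReal_one] at htop'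
  obtain ⟨m, hm⟩ := (htop'.eventually (lt_mem_nhds h1)).exists
  have := mem_range_of_exists_le_of_exists_ge hc ⟨-1, by simp only [hlow]; exact h0.le⟩
    ⟨(m : ℝ), hm.le⟩
  exact this

/-- **Bias concentration for nearest neighbors**: under the modified Lipschitz condition with
constants `cβ, β`, there is `b₃ > 0` depending only on `cβ` and `β` such that the averaged
target over the `k` nearest neighbors of a point `x` in the support (whose distance
distribution has a continuous cdf) deviates from the target by more than `t` with probability
at most `exp(−b₃ n t^{1/β})`, for `t` with `(t/cβ)^{1/β} ≥ 2k/n`. -/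
theorem bias_concentration_nearest_neighbors (β cβ : ℝ) (hβ : 0 < β) (hcβ : 0 < cβ) :
    ∃ b₃ : ℝ, 0 < b₃ ∧
      ∀ (X : Type uX) [MetricSpace X] [TopologicalSpace.SeparableSpace X]
        [MeasurableSpace X] [BorelSpace X]
        (H : Type) [NormedAddCommGroup H] [InnerProductSpace ℝ H]
        (μ : Measure X), IsProbabilityMeasure μ →
      ∀ x : X, x ∈ msupp μ →
        Continuous (fun t : ℝ => (μ {u | dist x u ≤ t}).toReal) →
      ∀ g : X → H,
        (∀ u ∈ msupp μ, ∀ v ∈ msupp μ,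
          ‖g u - g v‖ ≤ cβ * (μ (Metric.closedBall u (dist u v))).toReal ^ β) →
      ∀ n k : ℕ, 1 ≤ k → k ≤ n →
      ∀ t : ℝ, 0 < t → (2 * k : ℝ) / n ≤ (t / cβ) ^ (1 / β) →
        Measure.pi (fun _ : Fin n => μ)
            {ω | t < ‖(∑ i, nnWeight n k ω x i • g (ω i)) - g x‖}
          ≤ ENNReal.ofReal (exp (-(b₃ * n * t ^ (1 / β)))) := by
  have hcp : 0 < (1 / cβ) ^ (1 / β) := Real.rpow_pos_of_pos (by positivity) _
  refine ⟨(1 / cβ) ^ (1 / β) / 8, by positivity, ?_⟩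
  intro X _ _ _ _ H _ _ μ hμ x hx hc g hg n k hk hkn t ht hkt
  have hnpos : (0 : ℝ) < n := by exact_mod_cast (by omega : 0 < n)
  set s := (t / cβ) ^ (1 / β) with hs
  have hs0 : 0 < s := Real.rpow_pos_of_pos (by positivity) _
  have hse : s = (1 / cβ) ^ (1 / β) * t ^ (1 / β) := by
    rw [hs, ← Real.mul_rpow (by positivity) ht.le]; congr 1; ring
  have hsβ : cβ * s ^ β = t := by
    rw [hs, ← Real.rpow_mul (by positivity), one_div_mul_cancel hβ.ne', Real.rpow_one]
    field_simp
  have hexp : (1 / cβ) ^ (1 / β) / 8 * n * t ^ (1 / β) = n * s / 8 := by rw [hse]; ring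
  rw [hexp]
  have hsupp : ∀ᵐ ω ∂(Measure.pi (fun _ : Fin n => μ)), ∀ i, ω i ∈ msupp μ := by
    rw [ae_all_iff]
    intro i
    exact (measurePreserving_eval (fun _ : Fin n => μ) i).quasiMeasurePreserving.ae (msupp_ae μ)
  have hties := noties_ae μ x hc n
  have hbd : ∀ u ∈ msupp μ, (μ (Metric.closedBall x (dist x u))).toReal ≤ s →
      ‖g u - g x‖ ≤ t := by
    intro u hu hle
    rw [norm_sub_rev, ← hsβ]
    refine (hg x hx u hu).trans (mul_le_mul_of_nonneg_left ?_ hcβ.le)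
    exact Real.rpow_le_rpow ENNReal.toReal_nonneg hle hβ.le
  rcases le_or_gt 1 s with h1 | h1
  · have : Measure.pi (fun _ : Fin n => μ)
        {ω | t < ‖(∑ i, nnWeight n k ω x i • g (ω i)) - g x‖} = 0 := by
      have h : ∀ᵐ ω ∂(Measure.pi (fun _ : Fin n => μ)),
          ¬ t < ‖(∑ i, nnWeight n k ω x i • g (ω i)) - g x‖ := by
        filter_upwards [hsupp, hties] with ω h2 h3
        rw [not_lt]
        refine avg_bound n _ (nnWeight_nonneg n k ω x) (nnWeight_sum n k hk hkn ω x h3) _ _ t ?_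
        intro i _
        refine hbd _ (h2 i) (le_trans ?_ h1)
        exact ENNReal.toReal_le_of_le_ofReal (by norm_num) (by simpa using prob_le_one)
      simpa [ae_iff] using h
    rw [this]; exact zero_le
  · obtain ⟨r, hr⟩ := exists_radius μ x hc s hs0 h1
    have hA : MeasurableSet {u : X | dist x u ≤ r} :=
      (isClosed_le (by fun_prop) (by fun_prop)).measurableSet
    have hk' : 2 * (k : ℝ) ≤ n * s := by
      rw [div_le_iff₀ hnpos] at hkt; linarith
    refine le_trans (measure_mono_ae ?_) (chernoff_count μ _ hA n k s hr hk')
    filter_upwards [hsupp, hties] with ω h2 h3 hω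
    by_contra hcard
    have hcard' : k ≤ (Finset.univ.filter fun i => dist x (ω i) ≤ r).card := by
      have h := not_lt.1 hcard
      convert h using 2
    refine not_le.2 hω ?_
    refine avg_bound n _ (nnWeight_nonneg n k ω x) (nnWeight_sum n k hk hkn ω x h3) _ _ t ?_
    intro i hi
    refine hbd _ (h2 i) ?_
    rw [nnWeight_noties n k ω x h3] at hi
    have hlt : (Finset.univ.filter fun j => dist x (ω j) < dist x (ω i)).card < k := by
      by_contra h; simp [h] at hi
    have hir : dist x (ω i) ≤ r := by
      by_contra h
      push Not at h
      refine absurd (hcard'.trans (Finset.card_le_card ?_)) (not_le.2 hlt)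
      intro j
      simp only [Finset.mem_filter, Finset.mem_univ, true_and]
      exact fun hj => hj.trans_lt h
    rw [← hr]
    refine ENNReal.toReal_mono (measure_ne_top _ _) (measure_mono ?_)
    intro u hu
    rw [Metric.mem_closedBall, dist_comm] at hu
    exact hu.trans hir

end
end
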